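/- (Far-field estimate) Let α > 0. There exists a constant C, depending only on α, such that for every R > 0, every m ∈ (0, R/2], and every measurable set Ω ⊆ ℝ², the integrand y ↦ y₁/|y|^{2+2α} − y₁/|y−(0,m)|^{2+2α} is integrable over Ω ∖ [−R,R]² and | ∫_{Ω ∖ [−R,R]²} ( y₁/|y|^{2+2α} − y₁/|y−(0,m)|^{2+2α} ) dy | ≤ C R^{−2α} m. -/

import Mathlib

open Real MeasureTheory Set

noncomputable section

abbrev R2 : Type := EuclideanSpace ℝ (Fin 2)

def mk2 (a b : ℝ) : R2 := (EuclideanSpace.equiv (Fin 2) ℝ).symm ![a, b]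

/-- The integrand `y ↦ y₁/|y|^{2+2α} − y₁/|y−(0,m)|^{2+2α}` (with `y₁` the first coordinate
of `y` and `|·|` the Euclidean norm). -/
def farField (α m : ℝ) (y : R2) : ℝ :=
  y 0 / ‖y‖ ^ (2 + 2 * α) - y 0 / ‖y - mk2 0 m‖ ^ (2 + 2 * α)

/-- The square `[−R,R]²` in the plane. -/
def square (R : ℝ) : Set R2 := {y : R2 | |y 0| ≤ R ∧ |y 1| ≤ R}

lemma rpow_neg_diff (p a b m : ℝ) (hp : 0 < p) (ha : 0 < a) (hb : a / 2 ≤ b)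
    (hab : |a - b| ≤ m) :
    |a ^ (-p) - b ^ (-p)| ≤ p * (a / 2) ^ (-p - 1) * m := by
  have h := Convex.norm_image_sub_le_of_norm_hasDerivWithin_le (f := fun x : ℝ => x ^ (-p))
    (f' := fun x : ℝ => (-p) * x ^ (-p - 1)) (s := Ici (a / 2)) (x := b) (y := a)
    (C := p * (a / 2) ^ (-p - 1))
    (fun x hx => by
      have hx' : a / 2 ≤ x := hx
      exact (Real.hasDerivAt_rpow_const (Or.inl (by linarith))).hasDerivWithinAt)
    (fun x hx => by
      have hx' : a / 2 ≤ x := hx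
      have hx0 : 0 < x := by linarith
      rw [norm_mul, norm_neg, Real.norm_of_nonneg hp.le,
        Real.norm_of_nonneg (Real.rpow_nonneg hx0.le _)]
      exact mul_le_mul_of_nonneg_left
        (Real.rpow_le_rpow_of_nonpos (by linarith) hx' (by linarith)) hp.le)
    (convex_Ici _) hb (by simp only [mem_Ici]; linarith)
  simp only [Real.norm_eq_abs] at h
  refine h.trans (mul_le_mul_of_nonneg_left hab ?_)
  have : 0 < a / 2 := by linarith
  positivity

lemma norm_mk2 (m : ℝ) (hm : 0 < m) : ‖mk2 0 m‖ = m := by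
  simp [mk2, EuclideanSpace.norm_eq, Fin.sum_univ_two, hm.le]

lemma norm_gt (R : ℝ) (y : R2) (hy : y ∉ square R) : R < ‖y‖ := by
  by_contra! h
  apply hy
  have h0 := PiLp.norm_apply_le y 0
  have h1 := PiLp.norm_apply_le y 1
  rw [Real.norm_eq_abs] at h0 h1
  exact ⟨h0.trans h, h1.trans h⟩

lemma farField_bound (α m R : ℝ) (hα : 0 < α) (hm : 0 < m) (hR : m ≤ R / 2) (y : R2)
    (hy : R < ‖y‖) :
    |farField α m y| ≤
      (2 + 2 * α) * 2 ^ (3 + 2 * α) * m * ‖y‖ ^ (-(2 + 2 * α)) := by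
  have ha : 0 < ‖y‖ := by linarith
  have h1 : |‖y‖ - ‖y - mk2 0 m‖| ≤ m := by
    have := abs_norm_sub_norm_le y (y - mk2 0 m)
    rwa [sub_sub_cancel, norm_mk2 m hm] at this
  have hb : ‖y‖ / 2 ≤ ‖y - mk2 0 m‖ := by
    have := (abs_le.1 h1).2
    linarith
  have h2 := rpow_neg_diff (2 + 2 * α) _ _ m (by linarith) ha hb h1
  have h0 := PiLp.norm_apply_le y 0
  rw [Real.norm_eq_abs] at h0
  have e : farField α m y =
      y 0 * (‖y‖ ^ (-(2 + 2 * α)) - ‖y - mk2 0 m‖ ^ (-(2 + 2 * α))) := by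
    rw [farField, Real.rpow_neg ha.le, Real.rpow_neg (norm_nonneg _)]
    ring
  rw [e, abs_mul]
  refine (mul_le_mul h0 h2 (abs_nonneg _) ha.le).trans (le_of_eq ?_)
  rw [Real.div_rpow ha.le (by norm_num), Real.rpow_sub_one ha.ne',
    show (3 + 2 * α) = -(-(2 + 2 * α) - 1) by ring, Real.rpow_neg (by norm_num : (0:ℝ) ≤ 2) (-(2 + 2 * α) - 1)]
  field_simp

lemma radial (α R : ℝ) (hα : 0 < α) (hR : 0 < R) :
    Integrable (fun y : R2 => (Ioi R).indicator (fun r : ℝ => r ^ (-(2 + 2 * α))) ‖y‖) ∧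
    ∫ y : R2, (Ioi R).indicator (fun r : ℝ => r ^ (-(2 + 2 * α))) ‖y‖ =
      2 * volume.real (Metric.ball (0 : R2) 1) * (R ^ (-(2 * α)) / (2 * α)) := by
  have e : ∀ r : ℝ, r ^ (2 - 1) • (Ioi R).indicator (fun r : ℝ => r ^ (-(2 + 2 * α))) r
      = (Ioi R).indicator (fun r : ℝ => r ^ (-1 - 2 * α)) r := by
    intro r
    by_cases h : r ∈ Ioi R
    · have hr : 0 < r := hR.trans h
      rw [indicator_of_mem h, indicator_of_mem h, smul_eq_mul,
        show (-1 - 2 * α) = 1 + -(2 + 2 * α) by ring, Real.rpow_add hr]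
      simp
    · simp [indicator_of_notMem h]
  have hsub : Ioi (0:ℝ) ∩ Ioi R = Ioi R := inter_eq_right.2 (Ioi_subset_Ioi hR.le)
  constructor
  · rw [integrable_fun_norm_addHaar]
    simp only [finrank_euclideanSpace, Fintype.card_fin, e]
    refine IntegrableOn.mono_set (t := univ) ?_ (subset_univ _)
    rw [integrableOn_univ, integrable_indicator_iff measurableSet_Ioi]
    exact integrableOn_Ioi_rpow_of_lt (by linarith) hR
  · rw [integral_fun_norm_addHaar]
    simp only [finrank_euclideanSpace, Fintype.card_fin, e]
    rw [setIntegral_indicator measurableSet_Ioi, hsub, integral_Ioi_rpow_of_lt (by linarith) hR,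
      show (-1 - 2 * α + 1) = -(2 * α) by ring]
    simp only [nsmul_eq_mul, smul_eq_mul, Nat.cast_ofNat]
    rw [neg_div_neg_eq]
    ring

lemma meas_farField (α m : ℝ) : Measurable (farField α m) := by
  unfold farField
  fun_prop

/-- (Far-field estimate) For every `α > 0` there is `C = C(α)` such that for all `R > 0`,
`m ∈ (0,R/2]` and measurable `Ω ⊆ ℝ²`, the integrand `y ↦ y₁/|y|^{2+2α} − y₁/|y−(0,m)|^{2+2α}`
is integrable over `Ω ∖ [−R,R]²` and its integral there is at most `C R^{−2α} m` in absolute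
value. -/
theorem far_field_estimate (α : ℝ) (hα : 0 < α) :
    ∃ C : ℝ, 0 < C ∧ ∀ (R m : ℝ) (Ω : Set R2), 0 < R → 0 < m → m ≤ R / 2 → MeasurableSet Ω →
      IntegrableOn (farField α m) (Ω \ square R) volume ∧
        |∫ y in Ω \ square R, farField α m y| ≤ C * R ^ (-(2 * α)) * m := by
  have hV : 0 < volume.real (Metric.ball (0 : R2) 1) :=
    ENNReal.toReal_pos (Metric.measure_ball_pos _ _ one_pos).ne' measure_ball_lt_top.ne
  refine ⟨(2 + 2 * α) * 2 ^ (3 + 2 * α) * (2 * volume.real (Metric.ball (0 : R2) 1) / (2 * α)),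
    by positivity, ?_⟩
  intro R m Ω hR hm hmR hΩ
  obtain ⟨hi, hI⟩ := radial α R hα hR
  set K := (2 + 2 * α) * 2 ^ (3 + 2 * α) * m with hK
  have hK0 : 0 ≤ K := by positivity
  set g : R2 → ℝ := fun y => (Ioi R).indicator (fun r : ℝ => r ^ (-(2 + 2 * α))) ‖y‖ with hg
  have hg0 : ∀ y, 0 ≤ g y := fun y =>
    indicator_nonneg (fun r (hr : R < r) => Real.rpow_nonneg (hR.trans hr).le _) _
  have hsq : MeasurableSet (square R) := by
    have h0 : Measurable fun y : R2 => |y 0| := by fun_prop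
    have h1 : Measurable fun y : R2 => |y 1| := by fun_prop
    exact (measurableSet_le h0 measurable_const).inter (measurableSet_le h1 measurable_const)
  have hS := hΩ.diff hsq
  have hb : ∀ᵐ y ∂(volume.restrict (Ω \ square R)), ‖farField α m y‖ ≤ K * g y := by
    filter_upwards [ae_restrict_mem hS] with y hy
    have hy' := norm_gt R y hy.2
    have := farField_bound α m R hα hm hmR y hy'
    have hgy : g y = ‖y‖ ^ (-(2 + 2 * α)) :=
      indicator_of_mem (show ‖y‖ ∈ Ioi R from hy') _
    rwa [hgy, Real.norm_eq_abs]
  have hKi : Integrable (fun y => K * g y) := hi.const_mul K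
  refine ⟨hKi.integrableOn.mono' (meas_farField α m).aestronglyMeasurable hb, ?_⟩
  rw [← Real.norm_eq_abs]
  refine (norm_integral_le_of_norm_le hKi.integrableOn hb).trans ?_
  refine (setIntegral_le_integral hKi (Filter.Eventually.of_forall
    fun y => mul_nonneg hK0 (hg0 y))).trans ?_
  rw [integral_const_mul, hI, hK]
  apply le_of_eq
  ring

end
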